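/- For d ≥ 0, the real vector space of biharmonic functions on ℝⁿ with polynomial growth of rate d is finite dimensional, and for d ≥ 1 its dimension is bounded by C·d^{n-1} for a constant C depending only on n. -/

import Mathlib

open MeasureTheory

noncomputable def lap {n : ℕ} (u : EuclideanSpace ℝ (Fin n) → ℝ)
    (x : EuclideanSpace ℝ (Fin n)) : ℝ :=
  ∑ i : Fin n, fderiv ℝ (fun y => fderiv ℝ u y (EuclideanSpace.single i 1)) x
    (EuclideanSpace.single i 1)

/-- Membership in the space `H²_d(ℝⁿ)` of biharmonic functions with polynomial growth of
rate `d`. -/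
def memH2 {n : ℕ} (d : ℝ) (u : EuclideanSpace ℝ (Fin n) → ℝ) : Prop :=
  ContDiff ℝ (⊤ : ℕ∞) u ∧ (∀ x, lap (lap u) x = 0) ∧
    ∃ Cu : ℝ, 0 < Cu ∧ ∀ x, |u x| ≤ Cu * (1 + ‖x‖ ^ d)

open Filter Topology

theorem LinearIndependent.card_le_of_forall_mem_eq_zero {R M ι κ : Type*} [Field R]
    [AddCommGroup M] [Module R M] [Fintype ι] [Fintype κ] {W : Submodule R M} {v : ι → W}
    (hv : LinearIndependent R v) (f : M →ₗ[R] (κ → R)) (hf : ∀ u ∈ W, f u = 0 → u = 0) :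
    Fintype.card ι ≤ Fintype.card κ := by
  have hker : LinearMap.ker (f ∘ₗ W.subtype) = ⊥ :=
    LinearMap.ker_eq_bot'.2 fun u hu => Subtype.ext (hf u u.2 hu)
  have hcard := (hv.map' _ hker).fintype_card_le_finrank
  rwa [Module.finrank_fintype_fun_eq_card] at hcard

/-- The function `(1 - ‖y‖²)₊ᵏ`. -/
noncomputable def bubble (n k : ℕ) (y : EuclideanSpace ℝ (Fin n)) : ℝ :=
  max (1 - ‖y‖ ^ 2) 0 ^ k

theorem hasDerivAt_max_zero_pow {k : ℕ} (hk : k ≠ 0) (s : ℝ) :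
    HasDerivAt (fun s : ℝ => max s 0 ^ (k + 1)) ((k + 1) * max s 0 ^ k) s := by
  have off_zero : ∀ s : ℝ, s ≠ 0 →
      HasDerivAt (fun s : ℝ => max s 0 ^ (k + 1)) ((k + 1) * max s 0 ^ k) s := by
    intro s hs
    rcases lt_or_gt_of_ne hs with h | h
    · rw [max_eq_right h.le, zero_pow hk, mul_zero]
      refine (hasDerivAt_const s (0 : ℝ)).congr_of_eventuallyEq ?_
      filter_upwards [Iio_mem_nhds h] with r hr
      rw [max_eq_right (le_of_lt hr), zero_pow (Nat.succ_ne_zero k)]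
    · rw [max_eq_left h.le]
      have hpow := hasDerivAt_pow (k + 1) s
      simp only [Nat.add_sub_cancel, Nat.cast_add, Nat.cast_one] at hpow
      refine hpow.congr_of_eventuallyEq ?_
      filter_upwards [Ioi_mem_nhds h] with r hr
      rw [max_eq_left (le_of_lt hr)]
  by_cases hs : s = 0
  · subst hs
    exact hasDerivAt_of_hasDerivAt_of_ne (fun y hy => off_zero y hy)
      (by fun_prop) (by fun_prop)
  · exact off_zero s hs

section Bubble

variable {n : ℕ}

theorem continuous_bubble (k : ℕ) : Continuous (bubble n k) := by
  unfold bubble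
  fun_prop

theorem bubble_nonneg (k : ℕ) (y : EuclideanSpace ℝ (Fin n)) : 0 ≤ bubble n k y :=
  pow_nonneg (le_max_right _ _) _

theorem bubble_eq_zero {k : ℕ} (hk : k ≠ 0) {y : EuclideanSpace ℝ (Fin n)} (hy : 1 ≤ ‖y‖) :
    bubble n k y = 0 := by
  unfold bubble
  rw [max_eq_right (by nlinarith), zero_pow hk]

theorem hasCompactSupport_bubble {k : ℕ} (hk : k ≠ 0) : HasCompactSupport (bubble n k) :=
  HasCompactSupport.intro (isCompact_closedBall (0 : EuclideanSpace ℝ (Fin n)) 1) fun y hy =>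
    bubble_eq_zero hk (by simp at hy; exact hy.le)

theorem integrable_mul_bubble {k : ℕ} (hk : k ≠ 0) {f : EuclideanSpace ℝ (Fin n) → ℝ}
    (hf : Continuous f) : Integrable fun y => f y * bubble n k y :=
  (hf.mul (continuous_bubble k)).integrable_of_hasCompactSupport
    (hasCompactSupport_bubble hk).mul_left

theorem integrable_bubble {k : ℕ} (hk : k ≠ 0) : Integrable (bubble n k) :=
  (continuous_bubble k).integrable_of_hasCompactSupport (hasCompactSupport_bubble hk)

theorem integral_bubble_pos {k : ℕ} (hk : k ≠ 0) : 0 < ∫ y, bubble n k y := by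
  refine (continuous_bubble k).integral_pos_of_hasCompactSupport_nonneg_nonzero
    (hasCompactSupport_bubble hk) (bubble_nonneg k) (x := 0) ?_
  simp [bubble]

theorem hasFDerivAt_bubble {k : ℕ} (hk : k ≠ 0) (y : EuclideanSpace ℝ (Fin n)) :
    HasFDerivAt (bubble n (k + 1))
      ((-(2 * (k + 1)) * bubble n k y) • innerSL ℝ y) y := by
  have hinner : HasFDerivAt (fun y : EuclideanSpace ℝ (Fin n) => 1 - ‖y‖ ^ 2)
      (-(2 • innerSL ℝ y)) y := by
    simpa using ((hasStrictFDerivAt_norm_sq y).hasFDerivAt).const_sub 1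
  have hcomp := (hasDerivAt_max_zero_pow hk (1 - ‖y‖ ^ 2)).comp_hasFDerivAt y hinner
  refine hcomp.congr_fderiv ?_
  ext v
  simp [bubble]
  ring

theorem fderiv_bubble_single {k : ℕ} (hk : k ≠ 0) (y : EuclideanSpace ℝ (Fin n)) (i : Fin n) :
    fderiv ℝ (bubble n (k + 1)) y (EuclideanSpace.single i 1)
      = -(2 * (k + 1)) * (y i * bubble n k y) := by
  rw [(hasFDerivAt_bubble hk y).fderiv]
  simp [EuclideanSpace.inner_single_right]
  ring

/-- Integration by parts against a bubble. -/
theorem integral_fderiv_mul_bubble {k : ℕ} (hk : k ≠ 0) {f : EuclideanSpace ℝ (Fin n) → ℝ}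
    (hf : ContDiff ℝ 1 f) (i : Fin n) :
    ∫ y, fderiv ℝ f y (EuclideanSpace.single i 1) * bubble n (k + 1) y
      = 2 * (k + 1) * ∫ y, f y * y i * bubble n k y := by
  have hderiv : ∀ y, f y * fderiv ℝ (bubble n (k + 1)) y (EuclideanSpace.single i 1)
      = -(2 * (k + 1)) * (f y * y i * bubble n k y) := fun y => by
    rw [fderiv_bubble_single hk]
    ring
  have hcont : Continuous fun y : EuclideanSpace ℝ (Fin n) => f y * y i :=
    hf.continuous.mul (by fun_prop)
  have hparts := integral_mul_fderiv_eq_neg_fderiv_mul_of_integrable (μ := volume)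
    (f := f) (g := bubble n (k + 1)) (v := EuclideanSpace.single i 1)
    (integrable_mul_bubble k.succ_ne_zero
      ((hf.continuous_fderiv one_ne_zero).clm_apply continuous_const))
    (by
      simp only [hderiv]
      exact (integrable_mul_bubble hk hcont).const_mul _)
    (integrable_mul_bubble k.succ_ne_zero hf.continuous)
    (fun x _ => hf.differentiable one_ne_zero x)
    (fun x _ => (hasFDerivAt_bubble hk x).differentiableAt)
  simp only [hderiv] at hparts
  rw [integral_const_mul] at hparts
  linarith

theorem hasDerivAt_integral_dilation {k : ℕ} (hk : k ≠ 0) {w : EuclideanSpace ℝ (Fin n) → ℝ}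
    (hw : ContDiff ℝ 1 w) (x : EuclideanSpace ℝ (Fin n)) (t : ℝ) :
    HasDerivAt (fun t : ℝ => ∫ y, w (x + t • y) * bubble n k y)
      (∫ y, fderiv ℝ w (x + t • y) y * bubble n k y) t := by
  have hcont := hw.continuous
  have hfcont := hw.continuous_fderiv one_ne_zero
  have hcont2 : Continuous fun p : ℝ × EuclideanSpace ℝ (Fin n) =>
      fderiv ℝ w (x + p.1 • p.2) p.2 :=
    (hfcont.comp (by fun_prop)).clm_apply continuous_snd
  obtain ⟨M, hM⟩ := ((isCompact_closedBall t 1).prod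
    (isCompact_closedBall (0 : EuclideanSpace ℝ (Fin n)) 1)).exists_bound_of_continuousOn
      hcont2.continuousOn
  refine (hasDerivAt_integral_of_dominated_loc_of_deriv_le (Metric.ball_mem_nhds t one_pos)
    (bound := fun y => M * bubble n k y)
    (F' := fun t y => fderiv ℝ w (x + t • y) y * bubble n k y)
    (Eventually.of_forall fun s => ?_) (integrable_mul_bubble hk (by fun_prop)) ?_
    (Eventually.of_forall fun y s hs => ?_) ((integrable_bubble hk).const_mul M)
    (Eventually.of_forall fun y s hs => ?_)).2
  · exact (integrable_mul_bubble hk (by fun_prop)).aestronglyMeasurable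
  · exact (integrable_mul_bubble hk
      (hcont2.comp (continuous_const.prodMk continuous_id))).aestronglyMeasurable
  · rw [norm_mul, Real.norm_of_nonneg (bubble_nonneg k y)]
    rcases le_or_gt 1 ‖y‖ with hy | hy
    · simp [bubble_eq_zero hk hy]
    · exact mul_le_mul_of_nonneg_right
        (hM (s, y) ⟨Metric.ball_subset_closedBall hs, by simpa using hy.le⟩) (bubble_nonneg k y)
  · have hline : HasDerivAt (fun s : ℝ => x + s • y) y s := by
      simpa using ((hasDerivAt_id s).smul_const y).const_add x
    exact ((hw.differentiable one_ne_zero _).hasFDerivAt.comp_hasDerivAt s hline).mul_const _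

end Bubble

/-- The space of smooth real functions on `ℝⁿ`. -/
def smoothFun (n : ℕ) : Submodule ℝ (EuclideanSpace ℝ (Fin n) → ℝ) where
  carrier := {u | ContDiff ℝ (⊤ : ℕ∞) u}
  add_mem' {u v} hu hv := by
    rw [Set.mem_ofPred_eq] at *
    exact hu.add hv
  zero_mem' := by
    rw [Set.mem_ofPred_eq]
    exact contDiff_const
  smul_mem' c u hu := by
    rw [Set.mem_ofPred_eq] at *
    exact hu.const_smul c

namespace smoothFun

variable {n : ℕ}

theorem contDiff_top (u : smoothFun n) :
    ContDiff ℝ (⊤ : ℕ∞) (u : EuclideanSpace ℝ (Fin n) → ℝ) :=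
  u.2

theorem contDiff (u : smoothFun n) (m : ℕ) : ContDiff ℝ m (u : EuclideanSpace ℝ (Fin n) → ℝ) :=
  (contDiff_top u).of_le (by exact_mod_cast le_top)

theorem contDiff_one (u : smoothFun n) : ContDiff ℝ 1 (u : EuclideanSpace ℝ (Fin n) → ℝ) := by
  exact_mod_cast contDiff u 1

theorem differentiable (u : smoothFun n) :
    Differentiable ℝ (u : EuclideanSpace ℝ (Fin n) → ℝ) :=
  (contDiff_one u).differentiable one_ne_zero

theorem continuous (u : smoothFun n) : Continuous (u : EuclideanSpace ℝ (Fin n) → ℝ) :=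
  (contDiff_one u).continuous

/-- The partial derivative in the `i`-th coordinate direction. -/
noncomputable def pderiv (i : Fin n) : smoothFun n →ₗ[ℝ] smoothFun n where
  toFun u := ⟨fun y => fderiv ℝ (u : EuclideanSpace ℝ (Fin n) → ℝ) y (EuclideanSpace.single i 1),
    show ContDiff ℝ _ _ from
      ((contDiff_top u).fderiv_right (m := (⊤ : ℕ∞)) (by simp)).clm_apply contDiff_const⟩
  map_add' u v := by
    ext y
    simp [fderiv_add (differentiable u y) (differentiable v y)]
  map_smul' c u := by
    ext y
    simp [fderiv_const_smul (differentiable u y)]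

theorem pderiv_apply (i : Fin n) (u : smoothFun n) (y : EuclideanSpace ℝ (Fin n)) :
    (pderiv i u : EuclideanSpace ℝ (Fin n) → ℝ) y
      = fderiv ℝ (u : EuclideanSpace ℝ (Fin n) → ℝ) y (EuclideanSpace.single i 1) :=
  rfl

theorem pderiv_comm (i j : Fin n) (u : smoothFun n) :
    pderiv i (pderiv j u) = pderiv j (pderiv i u) := by
  have hdiff : Differentiable ℝ (fderiv ℝ (u : EuclideanSpace ℝ (Fin n) → ℝ)) :=
    ((contDiff u 2).fderiv_right (m := 1) (by norm_num)).differentiable one_ne_zero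
  ext y
  simp only [pderiv_apply]
  change fderiv ℝ (fun z => fderiv ℝ (u : EuclideanSpace ℝ (Fin n) → ℝ) z
      (EuclideanSpace.single j 1)) y _ = fderiv ℝ (fun z =>
      fderiv ℝ (u : EuclideanSpace ℝ (Fin n) → ℝ) z (EuclideanSpace.single i 1)) y _
  rw [fderiv_clm_apply (hdiff y) (differentiableAt_const _),
    fderiv_clm_apply (hdiff y) (differentiableAt_const _)]
  simpa using ((contDiff u 2).contDiffAt.isSymmSndFDerivAt (by simp)).eq
    (EuclideanSpace.single i 1) (EuclideanSpace.single j 1)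

theorem fderiv_eq_sum_pderiv (u : smoothFun n) (x v : EuclideanSpace ℝ (Fin n)) :
    fderiv ℝ (u : EuclideanSpace ℝ (Fin n) → ℝ) x v
      = ∑ i, v i * (pderiv i u : EuclideanSpace ℝ (Fin n) → ℝ) x := by
  conv_lhs => rw [← (EuclideanSpace.basisFun (Fin n) ℝ).sum_repr v]
  simp [pderiv_apply]

theorem eq_const_of_pderiv_eq_zero {u : smoothFun n} (hu : ∀ i, pderiv i u = 0)
    (x y : EuclideanSpace ℝ (Fin n)) :
    (u : EuclideanSpace ℝ (Fin n) → ℝ) x = (u : EuclideanSpace ℝ (Fin n) → ℝ) y := by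
  refine is_const_of_fderiv_eq_zero (𝕜 := ℝ) (differentiable u) (fun z => ?_) x y
  ext v
  simp [fderiv_eq_sum_pderiv, hu]

/-- The Laplacian on smooth functions. -/
noncomputable def laplacian : smoothFun n →ₗ[ℝ] smoothFun n :=
  ∑ i, pderiv i ∘ₗ pderiv i

theorem laplacian_eq_sum (u : smoothFun n) : laplacian u = ∑ i, pderiv i (pderiv i u) := by
  simp [laplacian]

theorem coe_laplacian (u : smoothFun n) :
    (laplacian u : EuclideanSpace ℝ (Fin n) → ℝ) = lap (u : EuclideanSpace ℝ (Fin n) → ℝ) := by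
  ext x
  simp only [laplacian_eq_sum, Submodule.coe_sum, Finset.sum_apply]
  rfl

theorem laplacian_pderiv (i : Fin n) (u : smoothFun n) :
    laplacian (pderiv i u) = pderiv i (laplacian u) := by
  simp [laplacian_eq_sum, pderiv_comm i]

/-- The dilation averages of `u` around `x` against a bubble. -/
noncomputable def bubbleMean (k : ℕ) (u : smoothFun n) (x : EuclideanSpace ℝ (Fin n)) (t : ℝ) :
    ℝ :=
  ∫ y, (u : EuclideanSpace ℝ (Fin n) → ℝ) (x + t • y) * bubble n k y

theorem bubbleMean_zero_right (k : ℕ) (u : smoothFun n) (x : EuclideanSpace ℝ (Fin n)) :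
    bubbleMean k u x 0 = (u : EuclideanSpace ℝ (Fin n) → ℝ) x * ∫ y, bubble n k y := by
  simp [bubbleMean, integral_const_mul]

theorem mul_bubbleMean_pderiv {k : ℕ} (hk : k ≠ 0) (u : smoothFun n) (i : Fin n)
    (x : EuclideanSpace ℝ (Fin n)) (t : ℝ) :
    t * bubbleMean (k + 1) (pderiv i u) x t
      = 2 * (k + 1) *
        ∫ y, (u : EuclideanSpace ℝ (Fin n) → ℝ) (x + t • y) * y i * bubble n k y := by
  have hdil : ContDiff ℝ 1 fun y => (u : EuclideanSpace ℝ (Fin n) → ℝ) (x + t • y) :=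
    (contDiff_one u).comp (by fun_prop)
  rw [← integral_fderiv_mul_bubble hk hdil, bubbleMean, ← integral_const_mul]
  congr 1
  ext y
  have hline : HasFDerivAt (fun y : EuclideanSpace ℝ (Fin n) => x + t • y)
      (t • ContinuousLinearMap.id ℝ _) y := ((hasFDerivAt_id y).const_smul t).const_add x
  have hcomp := (differentiable u (x + t • y)).hasFDerivAt.comp y hline
  rw [show (fun y => (u : EuclideanSpace ℝ (Fin n) → ℝ) (x + t • y)) =
    (u : EuclideanSpace ℝ (Fin n) → ℝ) ∘ fun y => x + t • y from rfl, hcomp.fderiv, pderiv_apply]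
  simp
  ring

theorem hasDerivAt_bubbleMean {k : ℕ} (hk : k ≠ 0) (u : smoothFun n)
    (x : EuclideanSpace ℝ (Fin n)) (t : ℝ) :
    HasDerivAt (bubbleMean k u x) (t / (2 * (k + 1)) * bubbleMean (k + 1) (laplacian u) x t) t := by
  refine (hasDerivAt_integral_dilation hk (contDiff_one u) x t).congr_deriv ?_
  have hcont : ∀ i, Continuous fun y : EuclideanSpace ℝ (Fin n) =>
      (pderiv i u : EuclideanSpace ℝ (Fin n) → ℝ) (x + t • y) * y i := fun i =>
    ((continuous (pderiv i u)).comp (by fun_prop)).mul (by fun_prop)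
  have hcont2 : ∀ i, Continuous fun y : EuclideanSpace ℝ (Fin n) =>
      (pderiv i (pderiv i u) : EuclideanSpace ℝ (Fin n) → ℝ) (x + t • y) := fun i =>
    (continuous (pderiv i (pderiv i u))).comp (by fun_prop)
  have hmean : bubbleMean (k + 1) (laplacian u) x t
      = ∑ i, bubbleMean (k + 1) (pderiv i (pderiv i u)) x t := by
    simp only [bubbleMean, laplacian_eq_sum, Submodule.coe_sum, Finset.sum_apply, Finset.sum_mul]
    exact integral_finsetSum _ fun i _ => integrable_mul_bubble k.succ_ne_zero (hcont2 i)
  have hsum : ∀ y : EuclideanSpace ℝ (Fin n),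
      fderiv ℝ (u : EuclideanSpace ℝ (Fin n) → ℝ) (x + t • y) y * bubble n k y
      = ∑ i, (pderiv i u : EuclideanSpace ℝ (Fin n) → ℝ) (x + t • y) * y i * bubble n k y := by
    intro y
    rw [fderiv_eq_sum_pderiv, Finset.sum_mul]
    exact Finset.sum_congr rfl fun i _ => by ring
  have hk2 : (2 * ((k : ℝ) + 1)) ≠ 0 := by positivity
  simp only [hsum]
  rw [integral_finsetSum _ fun i _ => integrable_mul_bubble hk (hcont i), hmean, div_mul_eq_mul_div,
    eq_div_iff hk2, Finset.sum_mul, Finset.mul_sum]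
  refine Finset.sum_congr rfl fun i _ => ?_
  rw [mul_bubbleMean_pderiv hk (pderiv i u) i x t, mul_comm]

theorem bubbleMean_of_laplacian_eq_zero {k : ℕ} (hk : k ≠ 0) {u : smoothFun n}
    (hu : laplacian u = 0) (x : EuclideanSpace ℝ (Fin n)) (t : ℝ) :
    bubbleMean k u x t = (u : EuclideanSpace ℝ (Fin n) → ℝ) x * ∫ y, bubble n k y := by
  rw [← bubbleMean_zero_right]
  refine is_const_of_deriv_eq_zero
    (fun s => (hasDerivAt_bubbleMean hk u x s).differentiableAt) (fun s => ?_) t 0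
  rw [(hasDerivAt_bubbleMean hk u x s).deriv, hu]
  simp [bubbleMean]

/-- The mean value property of biharmonic functions. -/
theorem bubbleMean_of_bilaplacian_eq_zero {k : ℕ} (hk : k ≠ 0) {u : smoothFun n}
    (hu : laplacian (laplacian u) = 0) (x : EuclideanSpace ℝ (Fin n)) (t : ℝ) :
    bubbleMean k u x t = (u : EuclideanSpace ℝ (Fin n) → ℝ) x * (∫ y, bubble n k y)
      + t ^ 2 * ((laplacian u : EuclideanSpace ℝ (Fin n) → ℝ) x * (∫ y, bubble n (k + 1) y)
        / (4 * (k + 1))) := by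
  set c := (laplacian u : EuclideanSpace ℝ (Fin n) → ℝ) x * (∫ y, bubble n (k + 1) y)
    / (4 * (k + 1)) with hc
  have hderiv : ∀ s, HasDerivAt (fun s => bubbleMean k u x s - s ^ 2 * c) 0 s := by
    intro s
    refine ((hasDerivAt_bubbleMean hk u x s).sub
      ((hasDerivAt_pow 2 s).mul_const c)).congr_deriv ?_
    rw [bubbleMean_of_laplacian_eq_zero k.succ_ne_zero hu, hc]
    have : (k : ℝ) + 1 ≠ 0 := by positivity
    push_cast
    field_simp
    ring
  have hconst := is_const_of_deriv_eq_zero (fun s => (hderiv s).differentiableAt)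
    (fun s => (hderiv s).deriv) t 0
  simp only [bubbleMean_zero_right] at hconst
  linarith

theorem mul_eq_bubbleMean {k : ℕ} (hk : k ≠ 0) {u : smoothFun n}
    (hu : laplacian (laplacian u) = 0) (x : EuclideanSpace ℝ (Fin n)) (t : ℝ) :
    3 * (∫ y, bubble n k y) * (u : EuclideanSpace ℝ (Fin n) → ℝ) x
      = 4 * bubbleMean k u x t - bubbleMean k u x (2 * t) := by
  rw [bubbleMean_of_bilaplacian_eq_zero hk hu, bubbleMean_of_bilaplacian_eq_zero hk hu]
  ring

/-- The interior gradient estimate for biharmonic functions. -/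
theorem abs_pderiv_le {u : smoothFun n} (hu : laplacian (laplacian u) = 0) (i : Fin n)
    (x : EuclideanSpace ℝ (Fin n)) {t M : ℝ} (ht : 0 < t)
    (hM : ∀ y : EuclideanSpace ℝ (Fin n), ‖y‖ ≤ ‖x‖ + 2 * t →
      |(u : EuclideanSpace ℝ (Fin n) → ℝ) y| ≤ M) :
    |(pderiv i u : EuclideanSpace ℝ (Fin n) → ℝ) x|
      ≤ 6 * (∫ y, bubble n 1 y) / (∫ y, bubble n 2 y) * (M / t) := by
  have hI : 0 < ∫ y, bubble n 2 y := integral_bubble_pos two_ne_zero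
  have hmoment : ∀ s : ℝ, |s| ≤ 2 * t →
      |s * bubbleMean 2 (pderiv i u) x s| ≤ 4 * (M * ∫ y, bubble n 1 y) := by
    intro s hs
    have hparts := mul_bubbleMean_pderiv one_ne_zero u i x s
    norm_num at hparts
    rw [hparts, abs_mul, abs_of_pos (by norm_num : (0 : ℝ) < 4), ← integral_const_mul]
    gcongr
    rw [← Real.norm_eq_abs]
    refine norm_integral_le_of_norm_le ((integrable_bubble one_ne_zero).const_mul M)
      (Eventually.of_forall fun y => ?_)
    rcases le_or_gt 1 ‖y‖ with hy | hy
    · simp [bubble_eq_zero one_ne_zero hy]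
    rw [norm_mul, norm_mul, Real.norm_of_nonneg (bubble_nonneg 1 y), Real.norm_eq_abs]
    refine mul_le_mul_of_nonneg_right ?_ (bubble_nonneg 1 y)
    have hball : |(u : EuclideanSpace ℝ (Fin n) → ℝ) (x + s • y)| ≤ M := by
      refine hM _ ((norm_add_le _ _).trans ?_)
      rw [norm_smul, Real.norm_eq_abs]
      nlinarith [abs_nonneg s, norm_nonneg y]
    have hcoord : ‖y i‖ ≤ 1 := (PiLp.norm_apply_le y i).trans hy.le
    calc _ ≤ |(u : EuclideanSpace ℝ (Fin n) → ℝ) (x + s • y)| * 1 := by gcongr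
      _ ≤ M := by linarith
  have hbi : laplacian (laplacian (pderiv i u)) = 0 := by
    rw [laplacian_pderiv, laplacian_pderiv, hu, map_zero]
  have h1 := abs_le.1 (hmoment t (by rw [abs_of_pos ht]; linarith))
  have h2 := abs_le.1 (hmoment (2 * t) (by rw [abs_of_pos (by linarith)]))
  have hmean := mul_eq_bubbleMean two_ne_zero hbi x t
  rw [div_mul_div_comm, le_div_iff₀ (by positivity), ← abs_of_pos (mul_pos hI ht), ← abs_mul,
    abs_le]
  have key : 3 * ((pderiv i u : EuclideanSpace ℝ (Fin n) → ℝ) x * ((∫ y, bubble n 2 y) * t))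
      = 4 * (t * bubbleMean 2 (pderiv i u) x t)
        - (2 * t * bubbleMean 2 (pderiv i u) x (2 * t)) / 2 := by
    linear_combination t * hmean
  constructor <;> linarith [h1.1, h1.2, h2.1, h2.2]

theorem pderiv_bilaplacian_eq_zero {u : smoothFun n} (hu : laplacian (laplacian u) = 0)
    (i : Fin n) : laplacian (laplacian (pderiv i u)) = 0 := by
  rw [laplacian_pderiv, laplacian_pderiv, hu, map_zero]

/-- `u` is bounded by a multiple of `(1 + ‖x‖) ^ e`. -/
def HasGrowth (e : ℝ) (u : smoothFun n) : Prop :=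
  ∃ C : ℝ, ∀ x, |(u : EuclideanSpace ℝ (Fin n) → ℝ) x| ≤ C * (1 + ‖x‖) ^ e

theorem exists_abs_pderiv_le {e : ℝ} (he : 0 ≤ e) {u : smoothFun n} (hgrowth : HasGrowth e u)
    (hu : laplacian (laplacian u) = 0) (i : Fin n) :
    ∃ C : ℝ, ∀ (x : EuclideanSpace ℝ (Fin n)) (t : ℝ), 1 + ‖x‖ ≤ t →
      |(pderiv i u : EuclideanSpace ℝ (Fin n) → ℝ) x| ≤ C * t ^ (e - 1) := by
  obtain ⟨C, hC⟩ := hgrowth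
  refine ⟨6 * (∫ y, bubble n 1 y) / (∫ y, bubble n 2 y) * (C * 3 ^ e), fun x t ht => ?_⟩
  have htpos : 0 < t := by linarith [norm_nonneg x]
  have hC0 : 0 ≤ C := by
    have h0 := (abs_nonneg _).trans (hC 0)
    simpa using h0
  refine (abs_pderiv_le hu i x htpos (M := C * (3 * t) ^ e) fun y hy => (hC y).trans ?_).trans_eq ?_
  · gcongr
    linarith
  · rw [Real.mul_rpow (by norm_num) htpos.le, Real.rpow_sub_one htpos.ne']
    ring

theorem HasGrowth.pderiv {e : ℝ} (he : 0 ≤ e) {u : smoothFun n} (hgrowth : HasGrowth e u)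
    (hu : laplacian (laplacian u) = 0) (i : Fin n) :
    HasGrowth (e - 1) (smoothFun.pderiv i u) := by
  obtain ⟨C, hC⟩ := exists_abs_pderiv_le he hgrowth hu i
  exact ⟨C, fun x => hC x _ le_rfl⟩

theorem HasGrowth.pderiv_eq_zero {e : ℝ} (he : 0 ≤ e) (he1 : e < 1) {u : smoothFun n}
    (hgrowth : HasGrowth e u) (hu : laplacian (laplacian u) = 0) (i : Fin n) :
    smoothFun.pderiv i u = 0 := by
  obtain ⟨C, hC⟩ := exists_abs_pderiv_le he hgrowth hu i
  ext x
  have hlim : Tendsto (fun t : ℝ => C * t ^ (e - 1)) atTop (𝓝 0) := by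
    have hrpow := tendsto_rpow_neg_atTop (y := 1 - e) (by linarith)
    rw [neg_sub] at hrpow
    simpa using hrpow.const_mul C
  have hle := ge_of_tendsto hlim ((eventually_ge_atTop (1 + ‖x‖)).mono fun t ht => hC x t ht)
  exact abs_nonpos_iff.1 hle

instance : LeftCommutative fun (i : Fin n) (u : smoothFun n) => pderiv i u :=
  ⟨fun i j u => pderiv_comm i j u⟩

/-- The iterated partial derivative along a multiset of coordinate directions. -/
noncomputable def multiPderiv (s : Multiset (Fin n)) : smoothFun n →ₗ[ℝ] smoothFun n where
  toFun u := s.foldr (fun i u => pderiv i u) u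
  map_add' u v := by
    induction s using Multiset.induction with
    | empty => rfl
    | cons i s ih => simp [ih]
  map_smul' c u := by
    induction s using Multiset.induction with
    | empty => rfl
    | cons i s ih => simp [ih]

theorem multiPderiv_cons (i : Fin n) (s : Multiset (Fin n)) (u : smoothFun n) :
    multiPderiv (i ::ₘ s) u = pderiv i (multiPderiv s u) :=
  Multiset.foldr_cons _ _ _ _

theorem multiPderiv_add (s t : Multiset (Fin n)) (u : smoothFun n) :
    multiPderiv (s + t) u = multiPderiv s (multiPderiv t u) :=
  Multiset.foldr_add _ _ _ _

theorem multiPderiv_cons' (i : Fin n) (s : Multiset (Fin n)) (u : smoothFun n) :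
    multiPderiv (i ::ₘ s) u = multiPderiv s (pderiv i u) := by
  rw [← Multiset.singleton_add, add_comm, multiPderiv_add]
  rfl

/-- **Liouville theorem** for biharmonic functions. -/
theorem multiPderiv_eq_zero_of_hasGrowth (s : Multiset (Fin n)) {e : ℝ} (he : 0 ≤ e)
    (hes : e < s.card) {u : smoothFun n} (hgrowth : HasGrowth e u)
    (hu : laplacian (laplacian u) = 0) : multiPderiv s u = 0 := by
  induction s using Multiset.induction generalizing e u with
  | empty => simp at hes; linarith
  | cons i s ih =>
    rw [multiPderiv_cons']
    rcases lt_or_ge e 1 with he1 | he1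
    · rw [hgrowth.pderiv_eq_zero he he1 hu, map_zero]
    · refine ih (e := e - 1) (by linarith) ?_ (hgrowth.pderiv he hu i)
        (pderiv_bilaplacian_eq_zero hu i)
      rw [Multiset.card_cons] at hes
      push_cast at hes
      linarith

theorem eq_zero_of_multiPderiv {u : smoothFun n} {k : ℕ}
    (hk : ∀ s : Multiset (Fin n), k < s.card → multiPderiv s u = 0)
    (h0 : ∀ s, (multiPderiv s u : EuclideanSpace ℝ (Fin n) → ℝ) 0 = 0) : u = 0 := by
  have descend : ∀ j (s : Multiset (Fin n)), k + 1 ≤ s.card + j → multiPderiv s u = 0 := by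
    intro j
    induction j with
    | zero => exact fun s hs => hk s (by omega)
    | succ j ih =>
      intro s hs
      ext x
      rw [eq_const_of_pderiv_eq_zero (u := multiPderiv s u) (fun i => ?_) x 0, h0 s]
      · rfl
      · rw [← multiPderiv_cons]
        exact ih _ (by rw [Multiset.card_cons]; omega)
  exact descend (k + 1) 0 (by simp)

/-- The fourth derivative of a biharmonic function in one direction is determined by the
derivatives which have lower order in that direction. -/
theorem multiPderiv_four_eq {u : smoothFun n} (hu : laplacian (laplacian u) = 0) (i : Fin n)
    (t : Multiset (Fin n)) :
    multiPderiv (t + {i, i, i, i}) u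
      = -∑ p ∈ Finset.univ.erase (i, i), multiPderiv (t + {p.1, p.1, p.2, p.2}) u := by
  have hsum : ∑ p : Fin n × Fin n, multiPderiv (t + {p.1, p.1, p.2, p.2}) u = 0 := by
    rw [← map_zero (multiPderiv t), ← hu, laplacian_eq_sum, Fintype.sum_prod_type, map_sum]
    refine Finset.sum_congr rfl fun j _ => ?_
    rw [laplacian_eq_sum, map_sum, map_sum, map_sum]
    exact Finset.sum_congr rfl fun l _ => multiPderiv_add _ _ _
  rw [← Finset.add_sum_erase _ _ (Finset.mem_univ (i, i))] at hsum
  exact eq_neg_of_add_eq_zero_left hsum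

theorem multiPderiv_apply_zero_of_count_le {u : smoothFun n}
    (hu : laplacian (laplacian u) = 0) (i : Fin n)
    (h0 : ∀ s : Multiset (Fin n), s.count i ≤ 3 →
      (multiPderiv s u : EuclideanSpace ℝ (Fin n) → ℝ) 0 = 0) (s : Multiset (Fin n)) :
    (multiPderiv s u : EuclideanSpace ℝ (Fin n) → ℝ) 0 = 0 := by
  induction hc : s.count i using Nat.strong_induction_on generalizing s with
  | _ c ih =>
    rcases le_or_gt c 3 with h3 | h3
    · exact h0 s (hc ▸ h3)
    obtain ⟨t, rfl⟩ : ∃ t, s = t + {i, i, i, i} := by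
      refine ⟨s - Multiset.replicate 4 i, (Multiset.sub_add_cancel ?_).symm⟩
      exact Multiset.le_count_iff_replicate_le.1 (by omega)
    rw [multiPderiv_four_eq hu]
    simp only [Submodule.coe_neg, Submodule.coe_sum, Pi.neg_apply, Finset.sum_apply,
      neg_eq_zero]
    refine Finset.sum_eq_zero fun p hp => ih _ ?_ _ rfl
    have hne : ¬(p.1 = i ∧ p.2 = i) := fun h => (Finset.mem_erase.1 hp).1 (Prod.ext h.1 h.2)
    rw [← hc]
    simp only [Multiset.count_add, Multiset.insert_eq_cons, Multiset.count_cons,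
      Multiset.count_singleton, if_true]
    split_ifs <;> omega

/-- The number of derivatives in direction `i` that determine a biharmonic polynomial of degree
at most `k`. -/
def cauchyOrder (k : ℕ) (i : Fin n) : ℕ :=
  if (i : ℕ) = 0 then 4 else k + 1

/-- The derivatives at the origin indexed by multi-indices bounded by `cauchyOrder`. -/
noncomputable def jet (n k : ℕ) : smoothFun n →ₗ[ℝ] ((∀ i : Fin n, Fin (cauchyOrder k i)) → ℝ) :=
  LinearMap.pi fun α => LinearMap.proj (0 : EuclideanSpace ℝ (Fin n)) ∘ₗ (smoothFun n).subtype ∘ₗ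
    multiPderiv (∑ i, (α i : ℕ) • {i})

theorem jet_apply (k : ℕ) (u : smoothFun n) (α : ∀ i : Fin n, Fin (cauchyOrder k i)) :
    jet n k u α = (multiPderiv (∑ i, (α i : ℕ) • {i}) u : EuclideanSpace ℝ (Fin n) → ℝ) 0 :=
  rfl

theorem eq_zero_of_jet_eq_zero {d : ℝ} (hd : 0 ≤ d) {u : smoothFun n} (hgrowth : HasGrowth d u)
    (hu : laplacian (laplacian u) = 0) (hjet : jet n ⌊d⌋₊ u = 0) : u = 0 := by
  have hvanish : ∀ s : Multiset (Fin n), ⌊d⌋₊ < s.card → multiPderiv s u = 0 := fun s hs =>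
    multiPderiv_eq_zero_of_hasGrowth s hd ((Nat.floor_lt hd).1 hs) hgrowth hu
  have hbounded : ∀ s : Multiset (Fin n), (∀ i : Fin n, (i : ℕ) = 0 → s.count i ≤ 3) →
      (multiPderiv s u : EuclideanSpace ℝ (Fin n) → ℝ) 0 = 0 := by
    intro s hs
    rcases lt_or_ge ⌊d⌋₊ s.card with hcard | hcard
    · rw [hvanish s hcard]
      rfl
    have hlt : ∀ i, s.count i < cauchyOrder ⌊d⌋₊ i := by
      intro i
      unfold cauchyOrder
      split_ifs with hi
      · exact Nat.lt_succ_of_le (hs i hi)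
      · exact Nat.lt_succ_of_le ((Multiset.count_le_card i s).trans hcard)
    have happly := congrFun hjet fun i => ⟨s.count i, hlt i⟩
    rw [jet_apply] at happly
    have hsum : ∑ i, s.count i • ({i} : Multiset (Fin n)) = s := by
      ext j
      simp [Multiset.count_sum', Multiset.count_nsmul, Multiset.count_singleton]
    simpa [hsum] using happly
  refine eq_zero_of_multiPderiv hvanish fun s => ?_
  rcases n with _ | m
  · exact hbounded s fun i => i.elim0
  · refine multiPderiv_apply_zero_of_count_le hu 0 (fun s hs => hbounded s fun i hi => ?_) s
    rwa [show i = 0 from Fin.ext hi]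

theorem card_cauchyIndex_le (n k : ℕ) :
    Fintype.card (∀ i : Fin n, Fin (cauchyOrder k i)) ≤ 4 * (k + 1) ^ (n - 1) := by
  rcases n with _ | m
  · simp
  · simp only [Fintype.card_pi, Fintype.card_fin, Fin.prod_univ_succ]
    simp [cauchyOrder]

/-- The biharmonic functions with growth of rate `d`. -/
def biharmonicGrowth (n : ℕ) (d : ℝ) : Submodule ℝ (smoothFun n) where
  carrier := {u | HasGrowth d u ∧ laplacian (laplacian u) = 0}
  add_mem' := by
    rintro u v ⟨⟨C, hC⟩, hu⟩ ⟨⟨D, hD⟩, hv⟩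
    refine ⟨⟨C + D, fun x => ?_⟩, by simp [hu, hv]⟩
    rw [add_mul]
    exact (abs_add_le _ _).trans (add_le_add (hC x) (hD x))
  zero_mem' := ⟨⟨0, by simp⟩, by simp⟩
  smul_mem' := by
    rintro c u ⟨⟨C, hC⟩, hu⟩
    refine ⟨⟨|c| * C, fun x => ?_⟩, by simp [hu]⟩
    rw [mul_assoc, Submodule.coe_smul, Pi.smul_apply, smul_eq_mul, abs_mul]
    exact mul_le_mul_of_nonneg_left (hC x) (abs_nonneg c)

theorem mem_biharmonicGrowth {d : ℝ} {u : smoothFun n} :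
    u ∈ biharmonicGrowth n d ↔ HasGrowth d u ∧ laplacian (laplacian u) = 0 :=
  Iff.rfl

theorem mem_biharmonicGrowth_of_memH2 {d : ℝ} (hd : 0 ≤ d) {u : smoothFun n}
    (hu : memH2 d (u : EuclideanSpace ℝ (Fin n) → ℝ)) : u ∈ biharmonicGrowth n d := by
  obtain ⟨-, hlap, C, hC0, hC⟩ := hu
  refine mem_biharmonicGrowth.2 ⟨⟨2 * C, fun x => (hC x).trans ?_⟩, ?_⟩
  · have h1 : (1 : ℝ) ≤ (1 + ‖x‖) ^ d := Real.one_le_rpow (by linarith [norm_nonneg x]) hd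
    have h2 : ‖x‖ ^ d ≤ (1 + ‖x‖) ^ d :=
      Real.rpow_le_rpow (norm_nonneg x) (by linarith) hd
    nlinarith
  · ext x
    rw [coe_laplacian, coe_laplacian]
    exact hlap x

theorem card_le_of_linearIndependent {d : ℝ} (hd : 0 ≤ d) {ι : Type*} [Fintype ι]
    {v : ι → biharmonicGrowth n d} (hv : LinearIndependent ℝ v) :
    Fintype.card ι ≤ 4 * (⌊d⌋₊ + 1) ^ (n - 1) :=
  (hv.card_le_of_forall_mem_eq_zero (jet n ⌊d⌋₊) fun _ hu =>
    eq_zero_of_jet_eq_zero hd hu.1 hu.2).trans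
    (card_cauchyIndex_le n _)

end smoothFun

theorem card_le_of_linearIndependent_memH2 {n : ℕ} {d : ℝ} (hd : 0 ≤ d)
    (s : Finset (EuclideanSpace ℝ (Fin n) → ℝ)) (hs : ∀ u ∈ s, memH2 d u)
    (hli : LinearIndependent ℝ (fun u : s => (u : EuclideanSpace ℝ (Fin n) → ℝ))) :
    s.card ≤ 4 * (⌊d⌋₊ + 1) ^ (n - 1) := by
  obtain ⟨v, hv⟩ : ∃ v : s → smoothFun.biharmonicGrowth n d,
      ∀ u, ((v u : smoothFun n) : EuclideanSpace ℝ (Fin n) → ℝ) = u :=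
    ⟨fun u => ⟨⟨u, (hs u u.2).1⟩, smoothFun.mem_biharmonicGrowth_of_memH2 hd (hs u u.2)⟩,
      fun _ => rfl⟩
  have hv_li : LinearIndependent ℝ v := by
    refine LinearIndependent.of_comp
      ((smoothFun n).subtype ∘ₗ (smoothFun.biharmonicGrowth n d).subtype) ?_
    convert hli using 1
    exact funext hv
  simpa using smoothFun.card_le_of_linearIndependent hd hv_li

/-- `H²_d(ℝⁿ)` is finite dimensional, with a Weyl type bound `C d^{n-1}` for `d ≥ 1`. -/
theorem H2_finite_dimensional_weyl (n : ℕ) :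
    (∀ d : ℝ, 0 ≤ d → ∃ N : ℕ, ∀ s : Finset (EuclideanSpace ℝ (Fin n) → ℝ),
      (∀ u ∈ s, memH2 d u) →
      LinearIndependent ℝ (fun u : s => (u : EuclideanSpace ℝ (Fin n) → ℝ)) →
      s.card ≤ N) ∧
    (∃ C : ℝ, 0 < C ∧ ∀ d : ℝ, 1 ≤ d → ∀ s : Finset (EuclideanSpace ℝ (Fin n) → ℝ),
      (∀ u ∈ s, memH2 d u) →
      LinearIndependent ℝ (fun u : s => (u : EuclideanSpace ℝ (Fin n) → ℝ)) →
      (s.card : ℝ) ≤ C * d ^ (n - 1)) := by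
  refine ⟨fun d hd => ⟨_, fun s hs hli => card_le_of_linearIndependent_memH2 hd s hs hli⟩,
    4 * 2 ^ (n - 1), by positivity, fun d hd s hs hli => ?_⟩
  have hd0 : 0 ≤ d := by linarith
  have hcard : (s.card : ℝ) ≤ 4 * ((⌊d⌋₊ : ℝ) + 1) ^ (n - 1) := by
    exact_mod_cast card_le_of_linearIndependent_memH2 hd0 s hs hli
  refine hcard.trans ?_
  rw [mul_assoc, ← mul_pow]
  have hfloor := Nat.floor_le hd0
  gcongr
  linarith
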